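/- As n → ∞ (over positive integers n), sup_{x ∈ [0,1]^ι} √n · | ∏_{i∈ι} ((a i + n·x i)/(n + c i))^{m i} − ∏_{i∈ι} (x i)^{m i} | → 0. -/

import Mathlib

open Filter Topology

/-- A monomial map is Lipschitz on every order interval `[l, u]` of `ι → ℝ`. -/
theorem exists_lipschitzOnWith_prod_pow_Icc {ι : Type*} [Fintype ι] (m : ι → ℕ) (l u : ι → ℝ) :
    ∃ K, LipschitzOnWith K (fun x : ι → ℝ => ∏ i, x i ^ m i) (Set.Icc l u) := by
  have h : ContDiff ℝ 1 (fun x : ι → ℝ => ∏ i, x i ^ m i) := by fun_prop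
  exact h.contDiffOn.exists_lipschitzOnWith one_ne_zero (convex_Icc l u) isCompact_Icc

/-- Uniform (over `x ∈ [0,1]^ι`) convergence to `0`, at rate faster than `1/√n`, of the
difference between the monomial `∏ i, (x i)^(m i)` and its "posterior-mean" perturbation
`∏ i, ((a i + n·x i)/(n + c i))^(m i)`, for nonnegative constants `a i, c i`. -/
theorem sup_sqrt_mul_abs_prod_sub_tendsto_zero {ι : Type*} [Fintype ι]
    (m : ι → ℕ) (a c : ι → ℝ) (ha : ∀ i, 0 ≤ a i) (hc : ∀ i, 0 ≤ c i) :
    Tendsto (fun n : ℕ =>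
        ⨆ x : (Set.Icc (0 : ι → ℝ) 1),
          Real.sqrt n *
            |(∏ i, ((a i + n * x.1 i) / (n + c i)) ^ m i) - ∏ i, (x.1 i) ^ m i|)
      atTop (𝓝 0) := by
  obtain ⟨K, hK⟩ := exists_lipschitzOnWith_prod_pow_Icc m 0 (1 + a)
  set C : ℝ := ∑ i, (a i + c i)
  have hC : 0 ≤ C := Finset.sum_nonneg fun i _ => add_nonneg (ha i) (hc i)
  have hlim : Tendsto (fun n : ℕ => K * C / √(n : ℝ)) atTop (𝓝 0) :=
    (Real.tendsto_sqrt_atTop.comp tendsto_natCast_atTop_atTop).const_div_atTop _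
  refine squeeze_zero' (.of_forall fun n => Real.iSup_nonneg fun x => by positivity) ?_ hlim
  filter_upwards [eventually_ge_atTop 1] with n hn
  have hn1 : (1 : ℝ) ≤ n := by exact_mod_cast hn
  have hn0 : (0 : ℝ) < n := by linarith
  refine Real.iSup_le ?_ (by positivity)
  rintro ⟨x, hx0, hx1⟩
  have hx0 : ∀ i, 0 ≤ x i := hx0
  have hx1 : ∀ i, x i ≤ 1 := hx1
  have hx : x ∈ Set.Icc (0 : ι → ℝ) (1 + a) :=
    ⟨hx0, fun i => (hx1 i).trans (le_add_of_nonneg_right (ha i))⟩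
  have hy : (fun i => (a i + n * x i) / (n + c i)) ∈ Set.Icc (0 : ι → ℝ) (1 + a) := by
    refine ⟨fun i => ?_, fun i => ?_⟩ <;> have := ha i <;> have := hc i <;> have := hx0 i
    · simp only [Pi.zero_apply]
      positivity
    · simp only [Pi.add_apply, Pi.one_apply]
      rw [div_le_iff₀ (by positivity)]
      nlinarith [mul_le_mul_of_nonneg_left (hx1 i) hn0.le, mul_nonneg (ha i) (hc i),
        mul_nonneg (ha i) (sub_nonneg.2 hn1)]
  have hdist : dist (fun i => (a i + n * x i) / (n + c i)) x ≤ C / n := by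
    refine (dist_pi_le_iff (by positivity)).2 fun i => ?_
    have hci := hc i
    have hpos : 0 < n + c i := by positivity
    have hsub : (a i + n * x i) / (n + c i) - x i = (a i - c i * x i) / (n + c i) := by
      field_simp
      ring
    rw [Real.dist_eq, hsub, abs_div, abs_of_pos hpos]
    have hnum : |a i - c i * x i| ≤ a i + c i := by
      have := mul_nonneg hci (hx0 i)
      have := mul_le_of_le_one_right hci (hx1 i)
      rw [abs_le]
      constructor <;> linarith [ha i]
    have hle : a i + c i ≤ C :=
      Finset.single_le_sum (f := fun i => a i + c i)
        (fun j _ => add_nonneg (ha j) (hc j)) (Finset.mem_univ i)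
    exact div_le_div₀ hC (hnum.trans hle) hn0 (by linarith)
  have hprod := hK.dist_le_mul _ hy _ hx
  rw [Real.dist_eq] at hprod
  calc √(n : ℝ) * |(∏ i, ((a i + n * x i) / (n + c i)) ^ m i) - ∏ i, x i ^ m i|
      ≤ √(n : ℝ) * (K * (C / n)) := by
        gcongr
        exact hprod.trans (by gcongr)
    _ = K * C / √(n : ℝ) := by
        have hs : 0 < √(n : ℝ) := Real.sqrt_pos.2 hn0
        field_simp
        rw [Real.sq_sqrt hn0.le]
        ring
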